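/- arXiv:2411.00364 — 3 statements merged into one kernel-verified Lean document; each statement's English description precedes it below -/
import Mathlib

section
/- Let n be an integer with n ≥ 2 and let bl := ⌊log₂(n − 1)⌋ + 1 be the binary length of n − 1. Define S : {0,1}^{bl} → ℤ by S(x₁, …, x_{bl}) = Σ_{i=1}^{bl−1} x_i · 2^{i−1} + (n − 1 − Σ_{i=1}^{bl−1} 2^{i−1}) · x_{bl}. Then the image of S is exactly the set of integers {0, 1, …, n − 1}. -/
theorem sum_Icc_two_pow_pred (k : ℕ) :
    ∑ i ∈ Finset.Icc 1 k, (2 : ℤ) ^ (i - 1) = 2 ^ k - 1 := by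
  induction k with
  | zero => simp
  | succ k ih =>
    rw [Finset.sum_Icc_succ_top (by omega), ih, Nat.add_sub_cancel]
    ring

theorem sum_Icc_binary_mem_Icc (k : ℕ) (x : ℕ → ℤ)
    (hx : ∀ i ∈ Finset.Icc 1 k, x i = 0 ∨ x i = 1) :
    ∑ i ∈ Finset.Icc 1 k, x i * 2 ^ (i - 1) ∈ Set.Icc (0 : ℤ) (2 ^ k - 1) := by
  rw [← sum_Icc_two_pow_pred]
  constructor
  · refine Finset.sum_nonneg fun i hi => ?_
    rcases hx i hi with h | h <;> simp [h]
  · refine Finset.sum_le_sum fun i hi => ?_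
    rcases hx i hi with h | h <;> simp [h]

theorem exists_binary_expansion (k : ℕ) (r : ℤ) (h0 : 0 ≤ r) (hr : r < 2 ^ k) :
    ∃ x : ℕ → ℤ, (∀ i, x i = 0 ∨ x i = 1) ∧
      ∑ i ∈ Finset.Icc 1 k, x i * 2 ^ (i - 1) = r := by
  induction k generalizing r with
  | zero => exact ⟨fun _ => 0, by simp, by simp at hr ⊢; omega⟩
  | succ k ih =>
    have extend (b s : ℤ) (hb : b = 0 ∨ b = 1) (hs0 : 0 ≤ s) (hs : s < 2 ^ k)
        (hrs : r = s + b * 2 ^ k) : ∃ x : ℕ → ℤ, (∀ i, x i = 0 ∨ x i = 1) ∧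
          ∑ i ∈ Finset.Icc 1 (k + 1), x i * 2 ^ (i - 1) = r := by
      obtain ⟨x, hx, hsum⟩ := ih s hs0 hs
      refine ⟨fun i => if i = k + 1 then b else x i, fun i => ?_, ?_⟩
      · dsimp only
        split_ifs
        exacts [hb, hx i]
      · rw [Finset.sum_Icc_succ_top (by omega), hrs, ← hsum]
        simp only [if_true, Nat.add_sub_cancel]
        congr 1
        refine Finset.sum_congr rfl fun i hi => ?_
        rw [if_neg (by have := Finset.mem_Icc.mp hi; omega)]
    rw [pow_succ] at hr
    by_cases h : r < 2 ^ k
    · exact extend 0 r (.inl rfl) h0 h (by ring)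
    · exact extend 1 (r - 2 ^ k) (.inr rfl) (by omega) (by omega) (by ring)

/-- For an integer `n ≥ 2`, with `bl = ⌊log₂(n − 1)⌋ + 1` the binary length of `n − 1`
(here `⌊log₂ m⌋ = Nat.log 2 m` for a positive integer `m`), the slack-variable map
`S(x₁, …, x_bl) = Σ_{i=1}^{bl−1} x_i · 2^(i−1) + (n − 1 − Σ_{i=1}^{bl−1} 2^(i−1)) · x_bl`
on binary inputs `x_i ∈ {0,1}` has image exactly `{0, 1, …, n − 1}`. -/
theorem slack_encoding_image (n : ℕ) (hn : 2 ≤ n) (bl : ℕ)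
    (hbl : bl = Nat.log 2 (n - 1) + 1) :
    {m : ℤ | ∃ x : ℕ → ℤ,
        (∀ i ∈ Finset.Icc 1 bl, x i = 0 ∨ x i = 1) ∧
        m = (∑ i ∈ Finset.Icc 1 (bl - 1), x i * 2 ^ (i - 1))
          + ((n : ℤ) - 1 - ∑ i ∈ Finset.Icc 1 (bl - 1), (2 : ℤ) ^ (i - 1)) * x bl}
      = Set.Icc (0 : ℤ) ((n : ℤ) - 1) := by
  obtain ⟨k, hk⟩ : ∃ k, k = Nat.log 2 (n - 1) := ⟨_, rfl⟩
  have hlow : (2 : ℤ) ^ k ≤ n - 1 := by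
    have h : 2 ^ k ≤ n - 1 := hk ▸ Nat.pow_log_le_self 2 (by omega)
    have h' : ((2 ^ k : ℕ) : ℤ) ≤ ((n - 1 : ℕ) : ℤ) := by exact_mod_cast h
    push_cast [Nat.cast_sub (show 1 ≤ n by omega)] at h'
    exact h'
  have hupp : (n : ℤ) - 1 < 2 * 2 ^ k := by
    have h : n - 1 < 2 ^ (k + 1) := hk ▸ Nat.lt_pow_succ_log_self one_lt_two (n - 1)
    have h' : ((n - 1 : ℕ) : ℤ) < ((2 ^ (k + 1) : ℕ) : ℤ) := by exact_mod_cast h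
    push_cast [Nat.cast_sub (show 1 ≤ n by omega), pow_succ] at h'
    linarith
  rw [← hk] at hbl
  subst hbl
  simp only [Nat.add_sub_cancel, sum_Icc_two_pow_pred]
  ext m
  simp only [Set.mem_ofPred_eq, Set.mem_Icc]
  constructor
  · rintro ⟨x, hx, rfl⟩
    obtain ⟨h0, h1⟩ := sum_Icc_binary_mem_Icc k x fun i hi =>
      hx i (Finset.Icc_subset_Icc_right (Nat.le_succ k) hi)
    rcases hx (k + 1) (by simp) with h | h <;> rw [h] <;> constructor <;> linarith
  · rintro ⟨h0, h1⟩
    have extend (b s : ℤ) (hb : b = 0 ∨ b = 1) (hs0 : 0 ≤ s) (hs : s < 2 ^ k)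
        (hms : m = s + ((n : ℤ) - 1 - (2 ^ k - 1)) * b) : ∃ x : ℕ → ℤ,
          (∀ i ∈ Finset.Icc 1 (k + 1), x i = 0 ∨ x i = 1) ∧
          m = (∑ i ∈ Finset.Icc 1 k, x i * 2 ^ (i - 1))
            + ((n : ℤ) - 1 - (2 ^ k - 1)) * x (k + 1) := by
      obtain ⟨x, hx, hsum⟩ := exists_binary_expansion k s hs0 hs
      refine ⟨fun i => if i = k + 1 then b else x i, fun i _ => ?_, ?_⟩
      · dsimp only
        split_ifs
        exacts [hb, hx i]
      · rw [hms, ← hsum]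
        simp only [if_true]
        congr 1
        refine Finset.sum_congr rfl fun i hi => ?_
        rw [if_neg (by have := Finset.mem_Icc.mp hi; omega)]
    by_cases h : m < 2 ^ k
    · exact extend 0 m (.inl rfl) h0 h (by ring)
    · exact extend 1 (m - ((n : ℤ) - 1 - (2 ^ k - 1))) (.inr rfl)
        (by linarith) (by linarith) (by ring)
end

section
/- Let n be an integer with n ≥ 2, let bl := ⌊log₂(n − 1)⌋ + 1, and let X₁, …, X_n ∈ {0,1}. Then X₁ + X₂ + ⋯ + X_n ≥ 1 if and only if there exist X′₁, …, X′_{bl} ∈ {0,1} such that X₁ + ⋯ + X_n − (Σ_{i=1}^{bl−1} X′_i · 2^{i−1} + (n − 1 − Σ_{i=1}^{bl−1} 2^{i−1}) · X′_{bl}) − 1 = 0. -/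
/-- The `k` lowest binary digits of `s` add up to `s % 2 ^ k`. -/
theorem sum_binary_digits_eq_mod (s k : ℕ) :
    ∑ i ∈ Finset.Icc 1 k, s / 2 ^ (i - 1) % 2 * 2 ^ (i - 1) = s % 2 ^ k := by
  induction k with
  | zero => simp [Nat.mod_one]
  | succ k ih =>
    rw [Finset.sum_Icc_succ_top (by omega), ih, Nat.add_sub_cancel, Nat.mod_pow_succ, mul_comm]

/-- Every integer in `[0, 2 ^ k - 1 + c]` with `0 ≤ c ≤ 2 ^ k` is a combination of the weights
`1, 2, …, 2 ^ (k - 1), c` with coefficients in `{0, 1}`. -/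
theorem exists_binary_slack (k : ℕ) (c s : ℤ) (hc : c ≤ 2 ^ k)
    (hs : 0 ≤ s) (hsc : s < 2 ^ k + c) :
    ∃ f : ℕ → ℤ, (∀ i, f i = 0 ∨ f i = 1) ∧
      ∑ i ∈ Finset.Icc 1 k, f i * 2 ^ (i - 1) + c * f (k + 1) = s := by
  obtain ⟨b, hb, h0, hlt⟩ : ∃ b : ℤ, (b = 0 ∨ b = 1) ∧ 0 ≤ s - c * b ∧ s - c * b < 2 ^ k := by
    rcases lt_or_ge s (2 ^ k) with h | h
    · exact ⟨0, Or.inl rfl, by simpa using hs, by simpa using h⟩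
    · exact ⟨1, Or.inr rfl, by linarith, by linarith⟩
  obtain ⟨t, ht⟩ := Int.eq_ofNat_of_zero_le h0
  have htk : t < 2 ^ k := by
    rw [ht] at hlt
    exact_mod_cast hlt
  refine ⟨fun i => if i = k + 1 then b else ((t / 2 ^ (i - 1) % 2 : ℕ) : ℤ), fun i => ?_, ?_⟩
  · dsimp only
    split_ifs
    · exact hb
    · exact_mod_cast Nat.mod_two_eq_zero_or_one _
  · have hdigits : ∑ i ∈ Finset.Icc 1 k,
        (if i = k + 1 then b else ((t / 2 ^ (i - 1) % 2 : ℕ) : ℤ)) * 2 ^ (i - 1) = t := by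
      calc _ = ∑ i ∈ Finset.Icc 1 k, ((t / 2 ^ (i - 1) % 2 * 2 ^ (i - 1) : ℕ) : ℤ) := by
            refine Finset.sum_congr rfl fun i hi => ?_
            have hne : i ≠ k + 1 := by have := Finset.mem_Icc.mp hi; omega
            rw [if_neg hne]
            push_cast
            rfl
        _ = t := by
            rw [← Nat.cast_sum, sum_binary_digits_eq_mod, Nat.mod_eq_of_lt htk]
    rw [hdigits]
    dsimp only
    rw [if_pos rfl]
    linarith


/-- For an integer `n ≥ 2`, with `bl = ⌊log₂(n − 1)⌋ + 1` (here `⌊log₂ m⌋ = Nat.log 2 m`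
for a positive integer `m`), and binary variables `X₁, …, X_n ∈ {0,1}`, the inequality
`X₁ + ⋯ + X_n ≥ 1` holds if and only if there exist binary slack variables
`X′₁, …, X′_bl ∈ {0,1}` with
`X₁ + ⋯ + X_n − (Σ_{i=1}^{bl−1} X′_i · 2^(i−1) + (n − 1 − Σ_{i=1}^{bl−1} 2^(i−1)) · X′_bl) − 1 = 0`. -/
theorem slack_encoding_constraint (n : ℕ) (hn : 2 ≤ n) (bl : ℕ)
    (hbl : bl = Nat.log 2 (n - 1) + 1)
    (X : ℕ → ℤ) (hX : ∀ i ∈ Finset.Icc 1 n, X i = 0 ∨ X i = 1) :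
    1 ≤ ∑ i ∈ Finset.Icc 1 n, X i ↔
      ∃ X' : ℕ → ℤ,
        (∀ i ∈ Finset.Icc 1 bl, X' i = 0 ∨ X' i = 1) ∧
        (∑ i ∈ Finset.Icc 1 n, X i)
          - ((∑ i ∈ Finset.Icc 1 (bl - 1), X' i * 2 ^ (i - 1))
            + ((n : ℤ) - 1 - ∑ i ∈ Finset.Icc 1 (bl - 1), (2 : ℤ) ^ (i - 1)) * X' bl)
          - 1 = 0 := by
  obtain ⟨k, hk⟩ : ∃ k, k = Nat.log 2 (n - 1) := ⟨_, rfl⟩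
  rw [← hk] at hbl
  subst hbl
  have hlow : (2 : ℤ) ^ k ≤ n - 1 := by
    have h : 2 ^ k ≤ n - 1 := hk ▸ Nat.pow_log_le_self 2 (by omega)
    have h' : 2 ^ k + 1 ≤ n := by omega
    have : (2 : ℤ) ^ k + 1 ≤ n := by exact_mod_cast h'
    linarith
  have hupp : (n : ℤ) ≤ 2 ^ k + 2 ^ k := by
    have h : n - 1 < 2 ^ (k + 1) := hk ▸ Nat.lt_pow_succ_log_self one_lt_two (n - 1)
    have h' : n ≤ 2 ^ k + 2 ^ k := by rw [pow_succ] at h; omega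
    exact_mod_cast h'
  have hsum : ∑ i ∈ Finset.Icc 1 n, X i ≤ n := by
    calc ∑ i ∈ Finset.Icc 1 n, X i ≤ ∑ i ∈ Finset.Icc 1 n, (1 : ℤ) :=
          Finset.sum_le_sum fun i hi => by rcases hX i hi with h | h <;> simp [h]
      _ = n := by simp
  rw [Nat.add_sub_cancel, sum_Icc_two_pow_pred]
  constructor
  · intro h
    obtain ⟨f, hf, hfs⟩ := exists_binary_slack k ((n : ℤ) - 1 - (2 ^ k - 1))
      (∑ i ∈ Finset.Icc 1 n, X i - 1) (by linarith) (by linarith) (by linarith)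
    exact ⟨f, fun i _ => hf i, by linarith⟩
  · rintro ⟨f, hf, hfs⟩
    have hnonneg : ∀ i ∈ Finset.Icc 1 (k + 1), 0 ≤ f i := fun i hi => by
      rcases hf i hi with h | h <;> simp [h]
    have hdigits : 0 ≤ ∑ i ∈ Finset.Icc 1 k, f i * 2 ^ (i - 1) :=
      Finset.sum_nonneg fun i hi => mul_nonneg
        (hnonneg i (Finset.Icc_subset_Icc_right k.le_succ hi)) (by positivity)
    have hlast : 0 ≤ ((n : ℤ) - 1 - (2 ^ k - 1)) * f (k + 1) :=
      mul_nonneg (by linarith) (hnonneg _ (by simp))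
    linarith
end

section
/- Let G = (V, E) be a finite simple graph with no isolated vertices, with degree function d and open neighborhoods N(i), and let P be a real number with P > |V|. For each vertex i with d_i ≥ 3 write bl_i := ⌊log₂(d_i − 1)⌋ + 1 and introduce slack bits X′_{i,1}, …, X′_{i,bl_i} ∈ {0,1}, with S_i := Σ_{k=1}^{bl_i−1} X′_{i,k} · 2^{k−1} + (d_i − 1 − Σ_{k=1}^{bl_i−1} 2^{k−1}) · X′_{i,bl_i}. Define the objective F(X, X′) := Σ_{i∈V} X_i + Σ_{i : d_i ≥ 3} P · (Σ_{j ∈ N(i)} X_j − S_i − 1)² + Σ_{i : d_i = 2, N(i) = {j,k}} P · (1 − X_j − X_k + X_j X_k) + Σ_{i : d_i = 1, N(i) = {j}} P · (X_j − 1)², over binary variables X : V → {0,1} and all slack bits. Then the minimum value of F equals the total domination number γ_t(G). -/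
theorem sum_Icc_two_pow_sub_one (m : ℕ) :
    ∑ k ∈ Finset.Icc 1 m, (2 : ℝ) ^ (k - 1) = 2 ^ m - 1 := by
  induction m with
  | zero => simp
  | succ m ih =>
    rw [Finset.sum_Icc_succ_top (by omega), ih, Nat.add_sub_cancel, pow_succ]
    ring

/-- Every natural number below `2 ^ m` has a binary expansion with `m` bits. -/
theorem exists_bits_sum_eq (m s : ℕ) (hs : s < 2 ^ m) :
    ∃ b : ℕ → ℝ, (∀ k, b k = 0 ∨ b k = 1) ∧
      ∑ k ∈ Finset.Icc 1 m, b k * 2 ^ (k - 1) = s := by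
  induction m generalizing s with
  | zero => exact ⟨fun _ => 0, by simp, by simp at hs; simp [hs]⟩
  | succ m ih =>
    have key : ∀ (c : ℝ) (t : ℕ), c = 0 ∨ c = 1 → t < 2 ^ m → (t : ℝ) + c * 2 ^ m = s →
        ∃ b : ℕ → ℝ, (∀ k, b k = 0 ∨ b k = 1) ∧
          ∑ k ∈ Finset.Icc 1 (m + 1), b k * 2 ^ (k - 1) = s := by
      intro c t hc ht hts
      obtain ⟨b, hb, hsum⟩ := ih t ht
      refine ⟨Function.update b (m + 1) c, fun k => ?_, ?_⟩
      · by_cases hk : k = m + 1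
        · subst hk; simpa using hc
        · simpa [Function.update_of_ne hk] using hb k
      · rw [Finset.sum_Icc_succ_top (by omega), Function.update_self, Nat.add_sub_cancel, ← hts,
          ← hsum]
        congr 1
        refine Finset.sum_congr rfl fun k hk => ?_
        rw [Finset.mem_Icc] at hk
        rw [Function.update_of_ne (by omega)]
    rcases lt_or_ge s (2 ^ m) with h | h
    · exact key 0 s (Or.inl rfl) h (by simp)
    · refine key 1 (s - 2 ^ m) (Or.inr rfl) (by rw [pow_succ] at hs; omega) ?_
      push_cast [Nat.cast_sub h]
      ring

/-- The slack encoding with last coefficient `d - 1 - ∑ 2 ^ (k - 1)` reaches every integer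
in `[0, d - 1]`. -/
theorem exists_slack_eq (d s : ℕ) (hd : 2 ≤ d) (hs : s ≤ d - 1) :
    ∃ b : ℕ → ℝ, (∀ k, b k = 0 ∨ b k = 1) ∧
      (∑ k ∈ Finset.Icc 1 (Nat.log 2 (d - 1)), b k * 2 ^ (k - 1))
        + ((d : ℝ) - 1 - ∑ k ∈ Finset.Icc 1 (Nat.log 2 (d - 1)), (2 : ℝ) ^ (k - 1))
          * b (Nat.log 2 (d - 1) + 1) = s := by
  have h1 : 2 ^ Nat.log 2 (d - 1) ≤ d - 1 := Nat.pow_log_le_self 2 (by omega)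
  have h2 : d - 1 < 2 ^ (Nat.log 2 (d - 1) + 1) := Nat.lt_pow_succ_log_self (by norm_num) _
  rw [sum_Icc_two_pow_sub_one]
  generalize Nat.log 2 (d - 1) = m at h1 h2 ⊢
  rw [pow_succ] at h2
  have key : ∀ (c : ℝ) (t : ℕ), c = 0 ∨ c = 1 → t < 2 ^ m →
      (t : ℝ) + ((d : ℝ) - 1 - (2 ^ m - 1)) * c = s →
      ∃ b : ℕ → ℝ, (∀ k, b k = 0 ∨ b k = 1) ∧
        (∑ k ∈ Finset.Icc 1 m, b k * 2 ^ (k - 1))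
          + ((d : ℝ) - 1 - (2 ^ m - 1)) * b (m + 1) = s := by
    intro c t hc ht hts
    obtain ⟨b, hb, hsum⟩ := exists_bits_sum_eq m t ht
    refine ⟨Function.update b (m + 1) c, fun k => ?_, ?_⟩
    · by_cases hk : k = m + 1
      · subst hk; simpa using hc
      · simpa [Function.update_of_ne hk] using hb k
    · rw [Function.update_self, ← hts, ← hsum]
      congr 1
      refine Finset.sum_congr rfl fun k hk => ?_
      rw [Finset.mem_Icc] at hk
      rw [Function.update_of_ne (by omega)]
  rcases lt_or_ge s (2 ^ m) with h | h
  · exact key 0 s (Or.inl rfl) h (by simp)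
  · refine key 1 (s - (d - 2 ^ m)) (Or.inr rfl) (by omega) ?_
    have h3 : d - 2 ^ m ≤ s := by omega
    have h4 : 2 ^ m ≤ d := by omega
    push_cast [Nat.cast_sub h3, Nat.cast_sub h4]
    ring

/-- The slack encoded by nonnegative bits is nonnegative. -/
theorem slack_nonneg (d : ℕ) (hd : 2 ≤ d) (b : ℕ → ℝ)
    (hb : ∀ k ∈ Finset.Icc 1 (Nat.log 2 (d - 1) + 1), b k = 0 ∨ b k = 1) :
    0 ≤ (∑ k ∈ Finset.Icc 1 (Nat.log 2 (d - 1)), b k * 2 ^ (k - 1))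
        + ((d : ℝ) - 1 - ∑ k ∈ Finset.Icc 1 (Nat.log 2 (d - 1)), (2 : ℝ) ^ (k - 1))
          * b (Nat.log 2 (d - 1) + 1) := by
  have hb0 : ∀ k ∈ Finset.Icc 1 (Nat.log 2 (d - 1) + 1), 0 ≤ b k := fun k hk => by
    rcases hb k hk with h | h <;> simp [h]
  have h1 : 2 ^ Nat.log 2 (d - 1) ≤ d := (Nat.pow_log_le_self 2 (by omega)).trans (by omega)
  have h1' : (2 : ℝ) ^ Nat.log 2 (d - 1) ≤ d := by exact_mod_cast h1
  rw [sum_Icc_two_pow_sub_one]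
  refine add_nonneg (Finset.sum_nonneg fun k hk => mul_nonneg (hb0 k ?_) (by positivity))
    (mul_nonneg (by linarith) (hb0 _ (by simp)))
  rw [Finset.mem_Icc] at hk ⊢
  omega

theorem one_sub_sum_add_prod_nonneg {V : Type*} {N : Finset V} (hN : N.card = 2)
    {X : V → ℝ} (hX : ∀ i, X i = 0 ∨ X i = 1) :
    0 ≤ 1 - (∑ j ∈ N, X j) + ∏ j ∈ N, X j := by
  classical
  obtain ⟨a, b, hab, rfl⟩ := Finset.card_eq_two.1 hN
  rw [Finset.sum_pair hab, Finset.prod_pair hab]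
  rcases hX a with h | h <;> rcases hX b with h' | h' <;> simp [h, h']

theorem one_sub_sum_add_prod_eq_zero {V : Type*} {N : Finset V} (hN : N.card = 2)
    {X : V → ℝ} (hX : ∀ i, X i = 0 ∨ X i = 1) (h1 : ∃ j ∈ N, X j = 1) :
    1 - (∑ j ∈ N, X j) + ∏ j ∈ N, X j = 0 := by
  classical
  obtain ⟨a, b, hab, rfl⟩ := Finset.card_eq_two.1 hN
  rw [Finset.sum_pair hab, Finset.prod_pair hab]
  rcases hX a with h | h <;> rcases hX b with h' | h' <;> simp [h, h'] at h1 ⊢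

/-- For a finite simple graph `G` with no isolated vertices and a penalty coefficient
`P > |V|`, the minimum value of the QUBO objective
`F(X, X′) = Σ_{i∈V} X_i + Σ_{i : d_i ≥ 3} P·(Σ_{j∈N(i)} X_j − S_i − 1)²`
`  + Σ_{i : d_i = 2, N(i) = {j,k}} P·(1 − X_j − X_k + X_j X_k)`
`  + Σ_{i : d_i = 1, N(i) = {j}} P·(X_j − 1)²`,
over binary variables `X : V → {0,1}` and binary slack bits
`X′_{i,1}, …, X′_{i,bl_i} ∈ {0,1}` (for each `i` with `d_i ≥ 3`, where
`bl_i = ⌊log₂(d_i − 1)⌋ + 1 = Nat.log 2 (d_i − 1) + 1` and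
`S_i = Σ_{k=1}^{bl_i−1} X′_{i,k}·2^(k−1) + (d_i − 1 − Σ_{k=1}^{bl_i−1} 2^(k−1))·X′_{i,bl_i}`),
equals the total domination number `γ_t(G)`, the minimum cardinality of a set `D`
such that every vertex of `V` has a neighbor in `D`.
For a vertex `i` of degree 2 with `N(i) = {j,k}`, the penalty
`1 − X_j − X_k + X_j·X_k` is written as `1 − Σ_{j∈N(i)} X_j + Π_{j∈N(i)} X_j`, and for a
vertex of degree 1 with `N(i) = {j}`, `(X_j − 1)²` is written as
`((Σ_{j∈N(i)} X_j) − 1)²`. -/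
theorem tdp_qubo_opt_eq_total_domination_number {V : Type*} [Fintype V] [DecidableEq V]
    (G : SimpleGraph V) [DecidableRel G.Adj]
    (hiso : ∀ v : V, 0 < G.degree v)
    (P : ℝ) (hP : (Fintype.card V : ℝ) < P) :
    IsLeast
      {y : ℝ | ∃ (X : V → ℝ) (X' : V → ℕ → ℝ),
        (∀ i : V, X i = 0 ∨ X i = 1) ∧
        (∀ i : V, 3 ≤ G.degree i →
          ∀ k ∈ Finset.Icc 1 (Nat.log 2 (G.degree i - 1) + 1), X' i k = 0 ∨ X' i k = 1) ∧
        y = (∑ i : V, X i)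
          + (∑ i ∈ Finset.univ.filter (fun i : V => 3 ≤ G.degree i),
              P * ((∑ j ∈ G.neighborFinset i, X j)
                  - ((∑ k ∈ Finset.Icc 1 (Nat.log 2 (G.degree i - 1)),
                        X' i k * 2 ^ (k - 1))
                    + ((G.degree i : ℝ) - 1
                        - ∑ k ∈ Finset.Icc 1 (Nat.log 2 (G.degree i - 1)),
                            (2 : ℝ) ^ (k - 1))
                      * X' i (Nat.log 2 (G.degree i - 1) + 1))
                  - 1) ^ 2)
          + (∑ i ∈ Finset.univ.filter (fun i : V => G.degree i = 2),
              P * (1 - (∑ j ∈ G.neighborFinset i, X j)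
                    + ∏ j ∈ G.neighborFinset i, X j))
          + (∑ i ∈ Finset.univ.filter (fun i : V => G.degree i = 1),
              P * ((∑ j ∈ G.neighborFinset i, X j) - 1) ^ 2)}
      ((sInf {k : ℕ | ∃ D : Finset V, (∀ v : V, ∃ u ∈ D, G.Adj v u) ∧ k = D.card} : ℕ) : ℝ) := by
  classical
  have hP0 : 0 ≤ P := (Nat.cast_nonneg _).trans hP.le
  constructor
  · obtain ⟨D, hD, hcard⟩ : sInf {k : ℕ | ∃ D : Finset V,
        (∀ v : V, ∃ u ∈ D, G.Adj v u) ∧ k = D.card} ∈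
        {k : ℕ | ∃ D : Finset V, (∀ v : V, ∃ u ∈ D, G.Adj v u) ∧ k = D.card} := by
      refine Nat.sInf_mem ⟨_, Finset.univ, fun v => ?_, rfl⟩
      obtain ⟨u, hu⟩ := (G.degree_pos_iff_exists_adj v).1 (hiso v)
      exact ⟨u, Finset.mem_univ u, hu⟩
    rw [hcard]
    set X : V → ℝ := fun i => if i ∈ D then 1 else 0 with hXdef
    have hX : ∀ i, X i = 0 ∨ X i = 1 := fun i => by
      by_cases h : i ∈ D <;> simp [hXdef, h]
    have hsum : ∀ i, ∑ j ∈ G.neighborFinset i, X j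
        = ((G.neighborFinset i ∩ D).card : ℝ) := fun i => by
      simp [hXdef, Finset.sum_ite_mem]
    have hpos : ∀ i, 0 < (G.neighborFinset i ∩ D).card := fun i => by
      obtain ⟨u, hu, hadj⟩ := hD i
      exact Finset.card_pos.2 ⟨u, by simp [hu, hadj]⟩
    have hle : ∀ i, (G.neighborFinset i ∩ D).card ≤ G.degree i := fun i => by
      rw [← G.card_neighborFinset_eq_degree]
      exact Finset.card_le_card Finset.inter_subset_left
    have hslack : ∀ i : V, ∃ b : ℕ → ℝ, 3 ≤ G.degree i → (∀ k, b k = 0 ∨ b k = 1) ∧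
        (∑ k ∈ Finset.Icc 1 (Nat.log 2 (G.degree i - 1)), b k * 2 ^ (k - 1))
          + ((G.degree i : ℝ) - 1
            - ∑ k ∈ Finset.Icc 1 (Nat.log 2 (G.degree i - 1)), (2 : ℝ) ^ (k - 1))
            * b (Nat.log 2 (G.degree i - 1) + 1)
          = (((G.neighborFinset i ∩ D).card - 1 : ℕ) : ℝ) := fun i => by
      by_cases hi : 3 ≤ G.degree i
      · obtain ⟨b, hb⟩ := exists_slack_eq (G.degree i) ((G.neighborFinset i ∩ D).card - 1)
          (by omega) (by have := hle i; omega)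
        exact ⟨b, fun _ => hb⟩
      · exact ⟨0, fun h => absurd h hi⟩
    choose X' hX' using hslack
    refine ⟨X, X', hX, fun i hi k _ => (hX' i hi).1 k, ?_⟩
    rw [Finset.sum_eq_zero (s := Finset.univ.filter (fun i : V => 3 ≤ G.degree i)),
      Finset.sum_eq_zero (s := Finset.univ.filter (fun i : V => G.degree i = 2)),
      Finset.sum_eq_zero (s := Finset.univ.filter (fun i : V => G.degree i = 1))]
    · simp [hXdef]
    · intro i hi
      have hd := (Finset.mem_filter.1 hi).2
      have h1 : (G.neighborFinset i ∩ D).card = 1 := by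
        have := hle i
        have := hpos i
        omega
      rw [hsum, h1]
      simp
    · intro i hi
      obtain ⟨u, hu, hadj⟩ := hD i
      rw [one_sub_sum_add_prod_eq_zero
        ((G.card_neighborFinset_eq_degree i).trans (Finset.mem_filter.1 hi).2) hX
        ⟨u, by simpa using hadj, by simp [hXdef, hu]⟩, mul_zero]
    · intro i hi
      rw [(hX' i (Finset.mem_filter.1 hi).2).2, hsum, Nat.cast_sub (hpos i)]
      simp
  · rintro y ⟨X, X', hX, hX', rfl⟩
    have hX0 : 0 ≤ ∑ i, X i := Finset.sum_nonneg fun i _ => by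
      rcases hX i with h | h <;> simp [h]
    have hA : ∀ i ∈ Finset.univ.filter (fun i : V => 3 ≤ G.degree i),
        0 ≤ P * ((∑ j ∈ G.neighborFinset i, X j)
                  - ((∑ k ∈ Finset.Icc 1 (Nat.log 2 (G.degree i - 1)),
                        X' i k * 2 ^ (k - 1))
                    + ((G.degree i : ℝ) - 1
                        - ∑ k ∈ Finset.Icc 1 (Nat.log 2 (G.degree i - 1)),
                            (2 : ℝ) ^ (k - 1))
                      * X' i (Nat.log 2 (G.degree i - 1) + 1))
                  - 1) ^ 2 := fun i _ => by positivity
    have hB : ∀ i ∈ Finset.univ.filter (fun i : V => G.degree i = 2),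
        0 ≤ P * (1 - (∑ j ∈ G.neighborFinset i, X j) + ∏ j ∈ G.neighborFinset i, X j) :=
      fun i hi => mul_nonneg hP0 (one_sub_sum_add_prod_nonneg
        ((G.card_neighborFinset_eq_degree i).trans (Finset.mem_filter.1 hi).2) hX)
    have hC : ∀ i ∈ Finset.univ.filter (fun i : V => G.degree i = 1),
        0 ≤ P * ((∑ j ∈ G.neighborFinset i, X j) - 1) ^ 2 := fun i _ => by positivity
    have hA' := Finset.sum_nonneg hA
    have hB' := Finset.sum_nonneg hB
    have hC' := Finset.sum_nonneg hC
    by_cases hdom : ∀ v : V, ∃ u ∈ Finset.univ.filter (fun i => X i = 1), G.Adj v u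
    · have hmin : sInf {k : ℕ | ∃ D : Finset V,
          (∀ v : V, ∃ u ∈ D, G.Adj v u) ∧ k = D.card}
          ≤ (Finset.univ.filter (fun i => X i = 1)).card :=
        Nat.sInf_le ⟨_, hdom, rfl⟩
      have hcard : ((Finset.univ.filter (fun i => X i = 1)).card : ℝ) = ∑ i, X i := by
        rw [Finset.card_filter, Nat.cast_sum]
        refine Finset.sum_congr rfl fun i _ => ?_
        rcases hX i with h | h <;> simp [h]
      have hmin' := (Nat.cast_le (α := ℝ)).2 hmin
      rw [hcard] at hmin'
      linarith
    · push Not at hdom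
      obtain ⟨v, hv⟩ := hdom
      have hmin : sInf {k : ℕ | ∃ D : Finset V,
          (∀ v : V, ∃ u ∈ D, G.Adj v u) ∧ k = D.card} ≤ Fintype.card V := by
        refine Nat.sInf_le ⟨Finset.univ, fun v => ?_, rfl⟩
        obtain ⟨u, hu⟩ := (G.degree_pos_iff_exists_adj v).1 (hiso v)
        exact ⟨u, Finset.mem_univ u, hu⟩
      have hmin' := (Nat.cast_le (α := ℝ)).2 hmin
      have hzero : ∀ j ∈ G.neighborFinset v, X j = 0 := fun j hj => by
        refine (hX j).resolve_right fun h => hv j (by simp [h]) ?_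
        simpa using hj
      have hs : ∑ j ∈ G.neighborFinset v, X j = 0 := Finset.sum_eq_zero hzero
      have hd := hiso v
      rcases (by omega : G.degree v = 1 ∨ G.degree v = 2 ∨ 3 ≤ G.degree v) with h | h | h
      · have hterm := Finset.single_le_sum hC (Finset.mem_filter.2 ⟨Finset.mem_univ v, h⟩)
        rw [hs] at hterm
        linarith
      · have hterm := Finset.single_le_sum hB (Finset.mem_filter.2 ⟨Finset.mem_univ v, h⟩)
        rw [hs] at hterm
        have hprod : 0 ≤ ∏ j ∈ G.neighborFinset v, X j :=
          Finset.prod_nonneg fun j hj => (hzero j hj).ge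
        have := mul_nonneg hP0 hprod
        linarith
      · have hterm := Finset.single_le_sum hA (Finset.mem_filter.2 ⟨Finset.mem_univ v, h⟩)
        have hS := slack_nonneg (G.degree v) (by omega) (X' v) (hX' v h)
        rw [hs] at hterm
        have hge : P ≤ _ := le_trans (le_mul_of_one_le_right hP0 (by nlinarith)) hterm
        linarith
end
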